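/- arXiv:2109.15204 — 2 statements merged into one kernel-verified Lean document; each statement's English description precedes it below -/
import Mathlib

section
/- Let s,m∈ℕ with s≥2 and let δ,β∈ℝ with β ≤ δ+3/2. Then the weighted Sobolev space H^{s+m}_δ(ℝ³) embeds continuously into the weighted Hölder space C^m_β(ℝ³): there is a constant C>0 such that ‖u‖_{C^m_β} ≤ C‖u‖_{H^{s+m}_δ} for all u∈H^{s+m}_δ. -/
noncomputable section

open Real MeasureTheory

/-- Spatial points x ∈ ℝ³. -/
abbrev Spc := Fin 3 → ℝ

/-- Spacetime points (t, x) ∈ ℝ × ℝ³. -/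
abbrev Pt := ℝ × Spc

/-- Euclidean radius r = |x|. -/
def rad (x : Spc) : ℝ := Real.sqrt (∑ i, x i ^ 2)

/-- Partial derivative in time, ∂_t. -/
def ptd (u : Pt → ℝ) (p : Pt) : ℝ := deriv (fun s => u (s, p.2)) p.1

/-- Partial derivative in the i-th spatial direction, ∂_i. -/
def pxd (i : Fin 3) (u : Pt → ℝ) (p : Pt) : ℝ :=
  deriv (fun s => u (p.1, Function.update p.2 i s)) (p.2 i)

/-- Radial derivative ∂_r = ω^i ∂_i, with ω_i = x_i / r. -/
def prd (u : Pt → ℝ) (p : Pt) : ℝ := ∑ i, (p.2 i / rad p.2) * pxd i u p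

/-- d'Alembertian □ = -∂_t² + Δ. -/
def box (u : Pt → ℝ) (p : Pt) : ℝ := - ptd (ptd u) p + ∑ i, pxd i (pxd i u) p

/-- Spacetime gradient ∂u = (∂_t u, ∂_1 u, ∂_2 u, ∂_3 u). -/
def sgrad (u : Pt → ℝ) (p : Pt) : Fin 4 → ℝ :=
  ![ptd u p, pxd 0 u p, pxd 1 u p, pxd 2 u p]

/-- Good spatial derivative ∂̄_i = ∂_i - ω_i ∂_r. -/
def gb (i : Fin 3) (u : Pt → ℝ) (p : Pt) : ℝ :=
  pxd i u p - (p.2 i / rad p.2) * prd u p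

/-- Good derivatives (∂̄_0, ∂̄_1, ∂̄_2, ∂̄_3), ∂̄_0 = (∂_t+∂_r)/2. -/
def gdrv (u : Pt → ℝ) (p : Pt) : Fin 4 → ℝ :=
  ![(ptd u p + prd u p) / 2, gb 0 u p, gb 1 u p, gb 2 u p]

/-- |∂u| = Σ_α |∂_α u|. -/
def gradAbs (u : Pt → ℝ) (p : Pt) : ℝ := ∑ α, |sgrad u p α|

/-- |∂̄u| = Σ_α |∂̄_α u|. -/
def gdrvAbs (u : Pt → ℝ) (p : Pt) : ℝ := ∑ α, |gdrv u p α|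

/-- Basic null form Q₀(X,Y) = -X₀Y₀ + δ^{ij}X_iY_j. -/
def Q0form (X Y : Fin 4 → ℝ) : ℝ := -(X 0 * Y 0) + X 1 * Y 1 + X 2 * Y 2 + X 3 * Y 3

/-- Basic null forms Q_{αβ}(X,Y) = X_αY_β - X_βY_α. -/
def Qform (a b : Fin 4) (X Y : Fin 4 → ℝ) : ℝ := X a * Y b - X b * Y a

/-- A null form is a linear combination of Q₀ and the Q_{αβ}. -/
def IsNullForm (Q : (Fin 4 → ℝ) → (Fin 4 → ℝ) → ℝ) : Prop :=
  ∃ (c : ℝ) (d : Fin 4 → Fin 4 → ℝ), ∀ X Y,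
    Q X Y = c * Q0form X Y + ∑ a, ∑ b, d a b * Qform a b X Y

/-- First-order operators acting on scalar functions on spacetime. -/
abbrev Op := (Pt → ℝ) → Pt → ℝ

/-- Scaling vector field S = t∂_t + r∂_r. -/
def vfS : Op := fun u p => p.1 * ptd u p + ∑ i, p.2 i * pxd i u p

/-- Rotations Ω_{ij} = x_i∂_j - x_j∂_i. -/
def vfRot (i j : Fin 3) : Op := fun u p => p.2 i * pxd j u p - p.2 j * pxd i u p

/-- Lorentz boosts Ω_{0i} = -t∂_i - x_i∂_t. -/
def vfBoost (i : Fin 3) : Op := fun u p => -(p.1 * pxd i u p) - p.2 i * ptd u p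

/-- The 11 Minkowski vector fields. -/
def mink : Fin 11 → Op :=
  ![ptd, pxd 0, pxd 1, pxd 2, vfS, vfBoost 0, vfBoost 1, vfBoost 2,
    vfRot 0 1, vfRot 0 2, vfRot 1 2]

/-- Application of a product Z^I of first-order operators, I given as a list. -/
def applyOps (L : List Op) (u : Pt → ℝ) : Pt → ℝ := L.foldr (fun Z v => Z v) u

/-- A multi-index: a word in the Minkowski vector fields. -/
def IsMulti (L : List Op) : Prop := ∀ Z ∈ L, ∃ n : Fin 11, Z = mink n

/-- A word in the spatial rotations only. -/
def IsRotMulti (L : List Op) : Prop :=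
  ∀ Z ∈ L, Z = vfRot 0 1 ∨ Z = vfRot 0 2 ∨ Z = vfRot 1 2

/-- The region A^R = {1/R ≤ r - t ≤ R}. -/
def regA (R : ℝ) : Set Pt := {p | 1 / R ≤ rad p.2 - p.1 ∧ rad p.2 - p.1 ≤ R}

/-- The region B^R = {r - t ≤ R}. -/
def regB (R : ℝ) : Set Pt := {p | rad p.2 - p.1 ≤ R}

/-- The region A₀^R = A^R ∩ {t = 0}. -/
def regA0 (R : ℝ) : Set Spc := {x | 1 / R ≤ rad x ∧ rad x ≤ R}

/-- L² norm of a function on a spatial slice. -/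
def L2 (f : Spc → ℝ) : ℝ := (∫ x : Spc, (f x) ^ 2) ^ (1/2 : ℝ)

/-- Weighted Sobolev norm ‖u‖_{H^m_δ} = Σ_{k≤m} ‖⟨x⟩^{δ+k} ∇^k u‖_{L²}. -/
def sobNorm (m : ℕ) (δ : ℝ) (u : Spc → ℝ) : ℝ :=
  ∑ k ∈ Finset.range (m + 1),
    (∫ x : Spc, ((1 + ∑ i, x i ^ 2) ^ ((δ + k) / 2) * ‖iteratedFDeriv ℝ k u x‖) ^ 2) ^ (1/2 : ℝ)

/-- Membership in the weighted Sobolev space H^m_δ (finiteness of the norm). -/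
def MemSob (m : ℕ) (δ : ℝ) (u : Spc → ℝ) : Prop :=
  ∀ k ≤ m, Integrable (fun x : Spc =>
    ((1 + ∑ i, x i ^ 2) ^ ((δ + k) / 2) * ‖iteratedFDeriv ℝ k u x‖) ^ 2)

/-- ‖f‖_{C^M} ≤ ε, stated derivative by derivative. -/
def CMBound (M : ℕ) (f : Spc → ℝ) (ε : ℝ) : Prop :=
  ∀ k ≤ M, ∀ x, ‖iteratedFDeriv ℝ k f x‖ ≤ ε

/-- The transport operator 𝓛 = ∂_t + ∂_r + 1/r. -/
def opLb : Op := fun u p => ptd u p + prd u p + u p / rad p.2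

/-- The spacetime gradient of u = t - r, namely (1, -ω₁, -ω₂, -ω₃). -/
def duTmR (p : Pt) : Fin 4 → ℝ :=
  ![1, -(p.2 0 / rad p.2), -(p.2 1 / rad p.2), -(p.2 2 / rad p.2)]

/-- Oscillating profiles T_λ^{(k,i)}. -/
def Ttrig (lam : ℝ) (k i : ℤ) (p : Pt) : ℝ :=
  if (k + i) % 2 = 0 then Real.cos (i * (p.1 - rad p.2) / lam)
  else Real.sin (i * (p.1 - rad p.2) / lam)

open scoped Pointwise
set_option maxSynthPendingDepth 5

theorem wse_taylor {E : Type*} [NormedAddCommGroup E] [NormedSpace ℝ E] [CompleteSpace E]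
    {V : Type*} [NormedAddCommGroup V] [NormedSpace ℝ V]
    (f : V → E) (hf : ContDiff ℝ 2 f) (x z : V) :
    ‖f x‖ ≤ ‖f (x + z)‖ + ‖fderiv ℝ f (x + z)‖ * ‖z‖ +
      (∫ t in Set.Ioc (0:ℝ) 1, t * ‖fderiv ℝ (fderiv ℝ f) (x + t • z)‖) * ‖z‖ ^ 2 := by
  have hf1 : ContDiff ℝ 1 (fderiv ℝ f) := hf.fderiv_right (by norm_num)
  have hf2 : Continuous (fderiv ℝ (fderiv ℝ f)) := hf1.continuous_fderiv (by norm_num)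
  have hline : ∀ t : ℝ, HasDerivAt (fun t : ℝ => x + t • z) z t := by
    intro t
    simpa using ((hasDerivAt_id t).smul_const z).const_add x
  have hg : ∀ t : ℝ, HasDerivAt (fun t : ℝ => f (x + t • z)) (fderiv ℝ f (x + t • z) z) t := by
    intro t
    exact ((hf.differentiable (by norm_num)) (x + t • z)).hasFDerivAt.comp_hasDerivAt t (hline t)
  have hg1 : ∀ t : ℝ, HasDerivAt (fun t : ℝ => fderiv ℝ f (x + t • z) z)
      (fderiv ℝ (fderiv ℝ f) (x + t • z) z z) t := by
    intro t
    have h1 := ((hf1.differentiable (by norm_num)) (x + t • z)).hasFDerivAt.comp_hasDerivAt t (hline t)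
    simpa using h1.clm_apply (hasDerivAt_const t z)
  have hh : ∀ t : ℝ, HasDerivAt (fun t : ℝ => f (x + t • z) - t • fderiv ℝ f (x + t • z) z)
      (-(t • fderiv ℝ (fderiv ℝ f) (x + t • z) z z)) t := by
    intro t
    have h1 := (hg t).sub ((hasDerivAt_id t).smul (hg1 t))
    refine h1.congr_deriv ?_
    simp
  have hcont : Continuous (fun t : ℝ => -(t • fderiv ℝ (fderiv ℝ f) (x + t • z) z z)) := by
    fun_prop
  have hF := intervalIntegral.integral_eq_sub_of_hasDerivAt (a := 0) (b := 1)
    (fun t _ => hh t) (hcont.intervalIntegrable 0 1)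
  have hn : ‖∫ t in (0:ℝ)..1, -(t • fderiv ℝ (fderiv ℝ f) (x + t • z) z z)‖ ≤
      (∫ t in Set.Ioc (0:ℝ) 1, t * ‖fderiv ℝ (fderiv ℝ f) (x + t • z)‖) * ‖z‖ ^ 2 := by
    rw [intervalIntegral.integral_of_le zero_le_one, ← integral_mul_const]
    refine (norm_integral_le_integral_norm _).trans ?_
    refine setIntegral_mono_on ?_ ?_ measurableSet_Ioc ?_
    · exact (hcont.norm.integrableOn_Icc).mono_set Set.Ioc_subset_Icc_self
    · have hlc : Continuous (fun t : ℝ => fderiv ℝ (fderiv ℝ f) (x + t • z)) :=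
        Continuous.comp (g := fderiv ℝ (fderiv ℝ f)) hf2 (by fun_prop)
      have : Continuous (fun t : ℝ => t * ‖fderiv ℝ (fderiv ℝ f) (x + t • z)‖ * ‖z‖ ^ 2) :=
        (continuous_id.mul hlc.norm).mul continuous_const
      exact this.integrableOn_Icc.mono_set Set.Ioc_subset_Icc_self
    · intro t ht
      rw [norm_neg, norm_smul, Real.norm_of_nonneg ht.1.le, mul_assoc]
      refine mul_le_mul_of_nonneg_left ?_ ht.1.le
      refine (ContinuousLinearMap.le_opNorm₂ _ z z).trans (le_of_eq (by ring))
  have he : f x = f (x + z) - fderiv ℝ f (x + z) z -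
      ∫ t in (0:ℝ)..1, -(t • fderiv ℝ (fderiv ℝ f) (x + t • z) z z) := by
    rw [hF]; simp
  rw [he]
  refine (norm_sub_le _ _).trans (add_le_add ((norm_sub_le _ _).trans ?_) hn)
  exact add_le_add le_rfl (ContinuousLinearMap.le_opNorm _ _)

theorem wse_norm2 {V : Type*} [NormedAddCommGroup V] [NormedSpace ℝ V]
    (u : V → ℝ) (k : ℕ) (y : V) :
    ‖fderiv ℝ (fderiv ℝ (iteratedFDeriv ℝ k u)) y‖ = ‖iteratedFDeriv ℝ (k + 2) u y‖ := by
  rw [← norm_fderiv_iteratedFDeriv (n := k + 1), fderiv_iteratedFDeriv (n := k),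
    LinearIsometryEquiv.comp_fderiv]
  exact LinearIsometry.norm_toContinuousLinearMap_comp
    (continuousMultilinearCurryLeftEquiv ℝ (fun _ : Fin (k + 1) => V) ℝ).toLinearIsometry

theorem wse_taylor_iter {V : Type*} [NormedAddCommGroup V] [NormedSpace ℝ V]
    (u : V → ℝ) (k : ℕ) (hu : ContDiff ℝ (k + 2 : ℕ) u) (x z : V) :
    ‖iteratedFDeriv ℝ k u x‖ ≤ ‖iteratedFDeriv ℝ k u (x + z)‖ +
      ‖iteratedFDeriv ℝ (k + 1) u (x + z)‖ * ‖z‖ +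
      (∫ t in Set.Ioc (0:ℝ) 1, t * ‖iteratedFDeriv ℝ (k + 2) u (x + t • z)‖) * ‖z‖ ^ 2 := by
  have hf : ContDiff ℝ 2 (iteratedFDeriv ℝ k u) :=
    hu.iteratedFDeriv_right (by rw [add_comm k 2]; norm_cast)
  have h := wse_taylor (iteratedFDeriv ℝ k u) hf x z
  simpa only [wse_norm2, norm_fderiv_iteratedFDeriv] using h

theorem wse_S (h : Spc → ℝ) (hc : Continuous h) (h0 : ∀ z, 0 ≤ h z) (r : ℝ) (hr : 0 < r) :
    ∫ y in Metric.closedBall (0 : Spc) 1, h (r • y) ≤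
      √8 * √((r ^ 3)⁻¹ * ∫ z in Metric.closedBall (0 : Spc) r, h z ^ 2) := by
  have hK : IsCompact (Metric.closedBall (0 : Spc) 1) := isCompact_closedBall _ _
  have hc' : Continuous fun y : Spc => h (r • y) := by fun_prop
  have : IsFiniteMeasure (volume.restrict (Metric.closedBall (0 : Spc) 1)) :=
    ⟨by rw [Measure.restrict_apply_univ]; exact hK.measure_lt_top⟩
  have hm : MemLp (fun y : Spc => h (r • y)) (ENNReal.ofReal 2)
      (volume.restrict (Metric.closedBall (0 : Spc) 1)) := by
    have : ENNReal.ofReal 2 = 2 := by norm_num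
    rw [this, memLp_two_iff_integrable_sq hc'.aestronglyMeasurable]
    exact (hc'.pow 2).continuousOn.integrableOn_compact hK
  have hv : (volume (Metric.closedBall (0 : Spc) 1)).toReal = 8 := by
    rw [Real.volume_pi_closedBall _ zero_le_one]; norm_num
  have := integral_mul_le_Lp_mul_Lq_of_nonneg (μ := volume.restrict (Metric.closedBall (0 : Spc) 1))
    Real.HolderConjugate.two_two (f := fun _ => (1:ℝ)) (g := fun y : Spc => h (r • y))
    (Filter.Eventually.of_forall fun _ => zero_le_one) (Filter.Eventually.of_forall fun _ => h0 _)
    (memLp_const _) hm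
  simp only [one_mul, Real.rpow_two] at this
  rw [← Real.sqrt_eq_rpow, ← Real.sqrt_eq_rpow] at this
  refine this.trans (le_of_eq ?_)
  have h2 := Measure.setIntegral_comp_smul_of_pos (volume : Measure Spc) (fun z => h z ^ 2)
    (Metric.closedBall (0 : Spc) 1) hr
  rw [h2]
  have h3 : r • Metric.closedBall (0 : Spc) 1 = Metric.closedBall (0 : Spc) r := by
    rw [smul_unitClosedBall, Real.norm_of_nonneg hr.le]
  rw [h3]
  congr 2
  · simp [Measure.real]
    norm_num
  · simp

theorem wse_local (a0 a1 a2 : Spc → ℝ) (c0 : Continuous a0) (c1 : Continuous a1)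
    (c2 : Continuous a2) (n0 : ∀ z, 0 ≤ a0 z) (n1 : ∀ z, 0 ≤ a1 z) (n2 : ∀ z, 0 ≤ a2 z)
    (A : ℝ)
    (hA : ∀ z, A ≤ a0 z + a1 z * ‖z‖ + (∫ t in Set.Ioc (0:ℝ) 1, t * a2 (t • z)) * ‖z‖ ^ 2)
    (R : ℝ) (hR : 0 < R) :
    A ≤ √((R ^ 3)⁻¹ * ∫ z in Metric.closedBall (0 : Spc) R, a0 z ^ 2) +
      R * √((R ^ 3)⁻¹ * ∫ z in Metric.closedBall (0 : Spc) R, a1 z ^ 2) +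
      2 * R ^ 2 * √((R ^ 3)⁻¹ * ∫ z in Metric.closedBall (0 : Spc) R, a2 z ^ 2) := by
  set B := Metric.closedBall (0 : Spc) 1 with hB
  have hK : IsCompact B := isCompact_closedBall _ _
  have hv : volume.real B = 8 := by
    rw [Measure.real, hB, Real.volume_pi_closedBall _ zero_le_one]; norm_num
  -- Fubini
  have hint : Integrable (Function.uncurry fun (t : ℝ) (y : Spc) => t * a2 ((t * R) • y))
      ((volume.restrict (Set.Ioc (0:ℝ) 1)).prod (volume.restrict B)) := by
    rw [Measure.prod_restrict]
    have hcc : Continuous (Function.uncurry fun (t : ℝ) (y : Spc) => t * a2 ((t * R) • y)) := by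
      unfold Function.uncurry
      fun_prop
    have : IntegrableOn (Function.uncurry fun (t : ℝ) (y : Spc) => t * a2 ((t * R) • y))
        (Set.Icc (0:ℝ) 1 ×ˢ B) (volume.prod volume) :=
      hcc.continuousOn.integrableOn_compact (isCompact_Icc.prod hK)
    exact this.mono_set (Set.prod_mono Set.Ioc_subset_Icc_self le_rfl)
  have hpt : ∀ y ∈ B, A ≤ a0 (R • y) + a1 (R • y) * R +
      (∫ t in Set.Ioc (0:ℝ) 1, t * a2 ((t * R) • y)) * R ^ 2 := by
    intro y hy
    have hy1 : ‖y‖ ≤ 1 := by simpa [hB] using hy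
    have hz : ‖R • y‖ ≤ R := by
      rw [norm_smul, Real.norm_of_nonneg hR.le]; nlinarith
    refine (hA (R • y)).trans ?_
    have e : (∫ t in Set.Ioc (0:ℝ) 1, t * a2 (t • R • y)) =
        ∫ t in Set.Ioc (0:ℝ) 1, t * a2 ((t * R) • y) := by
      simp only [smul_smul]
    have e0 : 0 ≤ ∫ t in Set.Ioc (0:ℝ) 1, t * a2 ((t * R) • y) :=
      setIntegral_nonneg measurableSet_Ioc fun t ht => mul_nonneg ht.1.le (n2 _)
    rw [e]
    gcongr
    exact n1 _
  have i0 : IntegrableOn (fun y : Spc => a0 (R • y)) B :=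
    (c0.comp (by fun_prop)).continuousOn.integrableOn_compact hK
  have i1 : IntegrableOn (fun y : Spc => a1 (R • y) * R) B :=
    ((c1.comp (by fun_prop)).mul continuous_const).continuousOn.integrableOn_compact hK
  have i2 : IntegrableOn
      (fun y : Spc => (∫ t in Set.Ioc (0:ℝ) 1, t * a2 ((t * R) • y)) * R ^ 2) B :=
    (hint.integral_prod_right).mul_const _
  have hconst : IntegrableOn (fun _ : Spc => A) B :=
    continuous_const.continuousOn.integrableOn_compact hK
  have hI := setIntegral_mono_on hconst ((i0.add i1).add i2) hK.measurableSet hpt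
  have hsplit : ∫ y in B, (a0 (R • y) + a1 (R • y) * R +
      (∫ t in Set.Ioc (0:ℝ) 1, t * a2 ((t * R) • y)) * R ^ 2) =
      (∫ y in B, a0 (R • y)) + (∫ y in B, a1 (R • y) * R) +
      ∫ y in B, (∫ t in Set.Ioc (0:ℝ) 1, t * a2 ((t * R) • y)) * R ^ 2 :=
    (integral_add (i0.add i1) i2).trans (congrArg (· + _) (integral_add i0 i1))
  replace hI := hI.trans_eq hsplit
  rw [setIntegral_const, hv,
    integral_mul_const, integral_mul_const, ← integral_integral_swap hint] at hI
  have s0 := wse_S a0 c0 n0 R hR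
  have s1 := wse_S a1 c1 n1 R hR
  set J2 := ∫ z in Metric.closedBall (0 : Spc) R, a2 z ^ 2 with hJ2
  have hrp : IntervalIntegrable (fun t : ℝ => t ^ (-(1/2) : ℝ)) volume 0 1 :=
    intervalIntegral.intervalIntegrable_rpow' (by norm_num)
  have s2 : ∫ t in Set.Ioc (0:ℝ) 1, ∫ y in B, t * a2 ((t * R) • y) ≤
      ∫ t in Set.Ioc (0:ℝ) 1, t ^ (-(1/2) : ℝ) * (√8 * √((R ^ 3)⁻¹ * J2)) := by
    refine setIntegral_mono_on hint.integral_prod_left ?_ measurableSet_Ioc ?_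
    · exact ((intervalIntegrable_iff_integrableOn_Ioc_of_le zero_le_one).1 hrp).mul_const _
    · intro t ht
      have ht0 : 0 < t := ht.1
      rw [integral_const_mul]
      have h := wse_S a2 c2 n2 (t * R) (mul_pos ht0 hR)
      have hm : ∫ z in Metric.closedBall (0 : Spc) (t * R), a2 z ^ 2 ≤ J2 := by
        refine setIntegral_mono_set ?_ (Filter.Eventually.of_forall fun z => by positivity) ?_
        · exact (c2.pow 2).continuousOn.integrableOn_compact (isCompact_closedBall _ _)
        · exact (Metric.closedBall_subset_closedBall (by nlinarith [ht.2])).eventuallyLE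
      have h2 : √(((t * R) ^ 3)⁻¹ * ∫ z in Metric.closedBall (0 : Spc) (t * R), a2 z ^ 2) ≤
          √((t^3)⁻¹ * ((R ^ 3)⁻¹ * J2)) := by
        refine Real.sqrt_le_sqrt ?_
        rw [mul_pow, mul_inv, mul_assoc]
        gcongr
      have h3 : t * √((t^3)⁻¹) = t ^ (-(1/2) : ℝ) := by
        rw [Real.sqrt_eq_rpow, ← Real.rpow_natCast, ← Real.rpow_neg ht0.le, ← Real.rpow_mul ht0.le]
        nth_rewrite 1 [← Real.rpow_one t]
        rw [← Real.rpow_add ht0]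
        norm_num
      rw [Real.sqrt_mul (by positivity) ((R ^ 3)⁻¹ * J2)] at h2
      calc t * ∫ y in B, a2 ((t * R) • y) ≤ t * (√8 * (√((t^3)⁻¹) * √((R ^ 3)⁻¹ * J2))) := by
            refine mul_le_mul_of_nonneg_left (h.trans ?_) ht0.le
            gcongr
        _ = (t * √((t^3)⁻¹)) * (√8 * √((R ^ 3)⁻¹ * J2)) := by ring
        _ = _ := by rw [h3]
  have hrv : ∫ t in Set.Ioc (0:ℝ) 1, t ^ (-(1/2) : ℝ) = 2 := by
    rw [← intervalIntegral.integral_of_le zero_le_one, integral_rpow (Or.inl (by norm_num))]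
    norm_num
  rw [integral_mul_const, hrv] at s2
  rw [smul_eq_mul] at hI
  set q0 := √((R ^ 3)⁻¹ * ∫ z in Metric.closedBall (0 : Spc) R, a0 z ^ 2)
  set q1 := √((R ^ 3)⁻¹ * ∫ z in Metric.closedBall (0 : Spc) R, a1 z ^ 2)
  set q2 := √((R ^ 3)⁻¹ * J2)
  have p0 : 0 ≤ q0 := Real.sqrt_nonneg _
  have p1 : 0 ≤ q1 := Real.sqrt_nonneg _
  have p2 : 0 ≤ q2 := Real.sqrt_nonneg _
  have h8 : √8 ≤ 8 := by rw [Real.sqrt_le_left (by norm_num)]; norm_num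
  have hS : 0 ≤ q0 + R * q1 + 2 * R ^ 2 * q2 := by positivity
  have hfin : 8 * A ≤ √8 * (q0 + R * q1 + 2 * R ^ 2 * q2) := by
    have t1 := mul_le_mul_of_nonneg_right s1 hR.le
    have t2 := mul_le_mul_of_nonneg_right s2 (sq_nonneg R)
    linarith
  nlinarith [mul_le_mul_of_nonneg_right h8 hS]

/-- Weight. -/
def wseW (x : Spc) : ℝ := 1 + ∑ i, x i ^ 2

theorem wseW_one_le (x : Spc) : 1 ≤ wseW x := by
  unfold wseW
  have : 0 ≤ ∑ i, x i ^ 2 := Finset.sum_nonneg fun i _ => sq_nonneg _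
  linarith

theorem wseW_comp (x z : Spc) (hz : ‖z‖ ≤ √(wseW x) / 4) :
    wseW x ≤ 4 * wseW (x + z) ∧ wseW (x + z) ≤ 4 * wseW x := by
  have h1 := wseW_one_le x
  have hs : √(wseW x) ^ 2 = wseW x := Real.sq_sqrt (by linarith)
  have hzi : ∀ i, z i ^ 2 ≤ wseW x / 16 := by
    intro i
    have := (norm_le_pi_norm z i).trans hz
    rw [Real.norm_eq_abs] at this
    rw [← sq_abs]
    nlinarith [abs_nonneg (z i)]
  have h0 := hzi 0
  have h1' := hzi 1
  have h2 := hzi 2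
  simp only [wseW, Fin.sum_univ_three, Pi.add_apply] at *
  constructor
  · nlinarith [sq_nonneg (x 0 + 2 * z 0), sq_nonneg (x 1 + 2 * z 1), sq_nonneg (x 2 + 2 * z 2)]
  · nlinarith [sq_nonneg (x 0 - z 0), sq_nonneg (x 1 - z 1), sq_nonneg (x 2 - z 2)]

theorem wse_rpow_comp (a p q : ℝ) (hp : 0 < p) (hq : 0 < q) (h1 : p ≤ 4 * q) (h2 : q ≤ 4 * p) :
    p ^ a ≤ 4 ^ |a| * q ^ a := by
  rcases le_total 0 a with h | h
  · rw [abs_of_nonneg h, ← Real.mul_rpow (by norm_num) hq.le]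
    exact Real.rpow_le_rpow hp.le h1 h
  · rw [abs_of_nonpos h]
    have : (4 * p) ^ a ≤ q ^ a := Real.rpow_le_rpow_of_nonpos hq h2 h
    rw [Real.mul_rpow (by norm_num) hp.le] at this
    calc p ^ a = 4 ^ (-a) * (4 ^ a * p ^ a) := by
          rw [← mul_assoc, ← Real.rpow_add (by norm_num)]; simp
      _ ≤ _ := by gcongr

theorem wse_weight (h : Spc → ℝ) (hc : Continuous h) (a : ℝ)
    (hi : Integrable fun y : Spc => ((1 + ∑ i, y i ^ 2) ^ (a / 2) * h y) ^ 2) (x : Spc) :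
    ∫ z in Metric.closedBall (0 : Spc) (√(wseW x) / 4), h (x + z) ^ 2 ≤
      4 ^ |a| * wseW x ^ (-a) *
        ∫ y : Spc, ((1 + ∑ i, y i ^ 2) ^ (a / 2) * h y) ^ 2 := by
  have hx := wseW_one_le x
  have hx0 : 0 < wseW x := by linarith
  have htr := integral_add_left_eq_self (μ := (volume : Measure Spc))
    (fun y : Spc => ((1 + ∑ i, y i ^ 2) ^ (a / 2) * h y) ^ 2) x
  have hi' := hi.comp_add_left x
  rw [← htr, ← integral_const_mul]
  refine le_trans ?_ (setIntegral_le_integral (s := Metric.closedBall (0 : Spc) (√(wseW x) / 4))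
    (hi'.const_mul _) (Filter.Eventually.of_forall fun z => by
      show (0:ℝ) ≤ _
      positivity))
  refine setIntegral_mono_on ?_ (hi'.const_mul _).integrableOn measurableSet_closedBall ?_
  · exact ((hc.comp (by fun_prop)).pow 2).continuousOn.integrableOn_compact (isCompact_closedBall _ _)
  · intro z hz
    have hz' : ‖z‖ ≤ √(wseW x) / 4 := by simpa using hz
    obtain ⟨g1, g2⟩ := wseW_comp x z hz'
    have hy := wseW_one_le (x + z)
    have hy0 : 0 < wseW (x + z) := by linarith
    have hr := wse_rpow_comp a _ _ hx0 hy0 g1 g2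
    change h (x + z) ^ 2 ≤ 4 ^ |a| * wseW x ^ (-a) * (wseW (x + z) ^ (a / 2) * h (x + z)) ^ 2
    have e : (wseW (x + z) ^ (a / 2)) ^ 2 = wseW (x + z) ^ a := by
      rw [← Real.rpow_natCast, ← Real.rpow_mul hy0.le]; congr 1; push_cast; ring
    rw [mul_pow, e]
    have e1 : wseW x ^ (-a) * wseW x ^ a = 1 := by rw [← Real.rpow_add hx0]; simp
    have hpos : 0 < wseW x ^ (-a) := Real.rpow_pos_of_pos hx0 _
    have : 1 ≤ wseW x ^ (-a) * (4 ^ |a| * wseW (x + z) ^ a) := by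
      rw [← e1]; gcongr
    nlinarith [mul_le_mul_of_nonneg_right this (sq_nonneg (h (x + z)))]

/-- One term of the final estimate. -/
theorem wse_term (h : Spc → ℝ) (hc : Continuous h) (a : ℝ) (j : ℕ)
    (hi : Integrable fun y : Spc => ((1 + ∑ i, y i ^ 2) ^ (a / 2) * h y) ^ 2) (x : Spc) :
    (√(wseW x) / 4) ^ j * √(((√(wseW x) / 4) ^ 3)⁻¹ *
      ∫ z in Metric.closedBall (0 : Spc) (√(wseW x) / 4), h (x + z) ^ 2) ≤
      8 * 2 ^ |a| * wseW x ^ (((j : ℝ) - a - 3 / 2) / 2) *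
        (∫ y : Spc, ((1 + ∑ i, y i ^ 2) ^ (a / 2) * h y) ^ 2) ^ (1 / 2 : ℝ) := by
  have hx0 : 0 < wseW x := by linarith [wseW_one_le x]
  have hw := wse_weight h hc a hi x
  set N := ∫ y : Spc, ((1 + ∑ i, y i ^ 2) ^ (a / 2) * h y) ^ 2 with hN
  have hN0 : 0 ≤ N := integral_nonneg fun y => by positivity
  set w := wseW x
  have e4 : (4 : ℝ) ^ |a| = (2 ^ |a|) ^ 2 := by
    rw [show (4:ℝ) = 2 ^ (2:ℕ) by norm_num, ← Real.rpow_natCast, ← Real.rpow_natCast,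
      ← Real.rpow_mul (by norm_num), ← Real.rpow_mul (by norm_num), mul_comm]
  have ea : w ^ (-a) = (w ^ (-a / 2)) ^ 2 := by
    rw [← Real.rpow_natCast, ← Real.rpow_mul hx0.le]; congr 1; push_cast; ring
  have es : √w = w ^ (1 / 2 : ℝ) := Real.sqrt_eq_rpow w
  have e3 : ((√w / 4) ^ 3)⁻¹ = (8 * w ^ (-3 / 4 : ℝ)) ^ 2 := by
    rw [es, div_pow, inv_div, mul_pow, div_eq_mul_inv, ← Real.rpow_natCast (w ^ (1/2 : ℝ)),
      ← Real.rpow_natCast (w ^ (-3/4 : ℝ)), ← Real.rpow_mul hx0.le, ← Real.rpow_mul hx0.le,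
      ← Real.rpow_neg hx0.le]
    norm_num
  have ej : (√w / 4) ^ j ≤ w ^ ((j : ℝ) / 2) := by
    have : (√w) ^ j = w ^ ((j : ℝ) / 2) := by
      rw [es, ← Real.rpow_natCast, ← Real.rpow_mul hx0.le]; congr 1; ring
    rw [← this]
    have := Real.sqrt_nonneg w
    gcongr
    linarith
  have hsq : √(((√w / 4) ^ 3)⁻¹ *
      ∫ z in Metric.closedBall (0 : Spc) (√w / 4), h (x + z) ^ 2) ≤
      8 * w ^ (-3 / 4 : ℝ) * (2 ^ |a| * w ^ (-a / 2)) * √N := by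
    have : √(((√w / 4) ^ 3)⁻¹ * ∫ z in Metric.closedBall (0 : Spc) (√w / 4), h (x + z) ^ 2) ≤
        √((8 * w ^ (-3 / 4 : ℝ) * (2 ^ |a| * w ^ (-a / 2))) ^ 2 * N) := by
      refine Real.sqrt_le_sqrt ?_
      rw [e3]
      refine (mul_le_mul_of_nonneg_left hw (sq_nonneg _)).trans (le_of_eq ?_)
      rw [e4, ea]; ring
    rwa [Real.sqrt_mul (sq_nonneg _), Real.sqrt_sq (by positivity)] at this
  rw [← Real.sqrt_eq_rpow]
  refine (mul_le_mul ej hsq (Real.sqrt_nonneg _) (by positivity)).trans (le_of_eq ?_)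
  have : w ^ (((j : ℝ) - a - 3 / 2) / 2) = w ^ ((j : ℝ) / 2) * w ^ (-3 / 4 : ℝ) * w ^ (-a / 2) := by
    rw [← Real.rpow_add hx0, ← Real.rpow_add hx0]; congr 1; ring
  rw [this]; ring

/-- weighted Sobolev embedding H^{s+m}_δ ↪ C^m_β for s ≥ 2, β ≤ δ + 3/2:
each term of the weighted Hölder norm ‖u‖_{C^m_β} is bounded by C‖u‖_{H^{s+m}_δ}. -/
theorem weighted_sobolev_embedding (s m : ℕ) (hs : 2 ≤ s) (δ β : ℝ) (hβ : β ≤ δ + 3/2) :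
    ∃ C > 0, ∀ u : Spc → ℝ, ContDiff ℝ (s + m : ℕ) u → MemSob (s + m) δ u →
      ∀ k ≤ m, ∀ x : Spc,
        (1 + ∑ i, x i ^ 2) ^ ((β + k) / 2) * ‖iteratedFDeriv ℝ k u x‖
          ≤ C * sobNorm (s + m) δ u := by
  refine ⟨4 * (8 * 2 ^ (|δ| + m + 2)), by positivity, ?_⟩
  intro u hu hM k hk x
  have hx0 : 0 < wseW x := by linarith [wseW_one_le x]
  set R := √(wseW x) / 4 with hRdef
  have hR : 0 < R := by positivity
  set w := wseW x with hw
  set K : ℝ := 8 * 2 ^ (|δ| + m + 2) with hK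
  have hterm : ∀ j ≤ 2, R ^ j * √((R ^ 3)⁻¹ *
      ∫ z in Metric.closedBall (0 : Spc) R, ‖iteratedFDeriv ℝ (k + j) u (x + z)‖ ^ 2) ≤
      K * w ^ (-(δ + 3 / 2 + k) / 2) * sobNorm (s + m) δ u := by
    intro j hj
    have hle : k + j ≤ s + m := by omega
    have hc : Continuous fun y => ‖iteratedFDeriv ℝ (k + j) u y‖ :=
      (hu.continuous_iteratedFDeriv (by exact_mod_cast hle)).norm
    refine (wse_term _ hc (δ + (k + j : ℕ)) j (hM _ hle) x).trans ?_
    have e1 : ((j : ℝ) - (δ + (k + j : ℕ)) - 3 / 2) / 2 = -(δ + 3 / 2 + k) / 2 := by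
      push_cast; ring
    rw [e1]
    have e2 : |δ + ((k + j : ℕ) : ℝ)| ≤ |δ| + m + 2 := by
      refine (abs_add_le _ _).trans ?_
      rw [Nat.abs_cast, add_assoc]
      have : ((k + j : ℕ) : ℝ) ≤ ((m + 2 : ℕ) : ℝ) := by exact_mod_cast (by omega)
      push_cast at this ⊢
      linarith
    have e3 : (2:ℝ) ^ |δ + ((k + j : ℕ) : ℝ)| ≤ 2 ^ (|δ| + m + 2) :=
      Real.rpow_le_rpow_of_exponent_le (by norm_num) e2
    have e4 : (∫ y : Spc, ((1 + ∑ i, y i ^ 2) ^ ((δ + (k + j : ℕ)) / 2) *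
        ‖iteratedFDeriv ℝ (k + j) u y‖) ^ 2) ^ (1 / 2 : ℝ) ≤ sobNorm (s + m) δ u := by
      unfold sobNorm
      refine Finset.single_le_sum (f := fun k : ℕ => (∫ x : Spc, ((1 + ∑ i, x i ^ 2) ^
        ((δ + k) / 2) * ‖iteratedFDeriv ℝ k u x‖) ^ 2) ^ (1/2 : ℝ)) (fun i _ => ?_)
        (Finset.mem_range.2 (by omega))
      exact Real.rpow_nonneg (integral_nonneg fun y => by positivity) _
    refine mul_le_mul ?_ e4 (Real.rpow_nonneg (integral_nonneg fun y => by positivity) _)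
      (by positivity)
    rw [hK]
    gcongr
  have hcx : ∀ j ≤ 2, Continuous fun z => ‖iteratedFDeriv ℝ (k + j) u (x + z)‖ := by
    intro j hj
    have hle : k + j ≤ s + m := by omega
    have hc : Continuous fun y => ‖iteratedFDeriv ℝ (k + j) u y‖ :=
      (hu.continuous_iteratedFDeriv (by exact_mod_cast hle)).norm
    exact hc.comp (continuous_const.add continuous_id)
  have hloc := wse_local (fun z => ‖iteratedFDeriv ℝ k u (x + z)‖)
    (fun z => ‖iteratedFDeriv ℝ (k + 1) u (x + z)‖) (fun z => ‖iteratedFDeriv ℝ (k + 2) u (x + z)‖)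
    (hcx 0 (by norm_num)) (hcx 1 (by norm_num)) (hcx 2 le_rfl) (fun _ => norm_nonneg _)
    (fun _ => norm_nonneg _) (fun _ => norm_nonneg _) ‖iteratedFDeriv ℝ k u x‖
    (fun z => wse_taylor_iter u k (hu.of_le (by exact_mod_cast (by omega))) x z) R hR
  have t0 : √((R ^ 3)⁻¹ * ∫ z in Metric.closedBall (0 : Spc) R,
      ‖iteratedFDeriv ℝ k u (x + z)‖ ^ 2) ≤
      K * w ^ (-(δ + 3 / 2 + k) / 2) * sobNorm (s + m) δ u := by
    have := hterm 0 (by norm_num)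
    rw [pow_zero, one_mul] at this
    exact this
  have t1 := hterm 1 (by norm_num)
  have t2 := hterm 2 (by norm_num)
  rw [pow_one] at t1
  have hmain : ‖iteratedFDeriv ℝ k u x‖ ≤
      4 * (K * w ^ (-(δ + 3 / 2 + k) / 2) * sobNorm (s + m) δ u) := by linarith
  have hS0 : 0 ≤ sobNorm (s + m) δ u := Finset.sum_nonneg fun i _ =>
    Real.rpow_nonneg (integral_nonneg fun y => by positivity) _
  have hwp : w ^ ((β + k) / 2) ≤ w ^ ((δ + 3 / 2 + k) / 2) :=
    Real.rpow_le_rpow_of_exponent_le (wseW_one_le x) (by linarith)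
  change w ^ ((β + k) / 2) * _ ≤ _
  have e1 : w ^ ((δ + 3 / 2 + k) / 2) * w ^ (-(δ + 3 / 2 + k) / 2) = 1 := by
    rw [← Real.rpow_add hx0, neg_div, add_neg_cancel, Real.rpow_zero]
  calc w ^ ((β + k) / 2) * ‖iteratedFDeriv ℝ k u x‖
      ≤ w ^ ((δ + 3 / 2 + k) / 2) *
        (4 * (K * w ^ (-(δ + 3 / 2 + k) / 2) * sobNorm (s + m) δ u)) := by gcongr
    _ = 4 * K * sobNorm (s + m) δ u *
        (w ^ ((δ + 3 / 2 + k) / 2) * w ^ (-(δ + 3 / 2 + k) / 2)) := by ring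
    _ = _ := by rw [e1, mul_one]
end
end

section
/- Let M∈ℕ, R>0. There exist ε_0>0 and C>0 (depending on M,R) such that for all 0<ε≤ε_0 the following holds. Let f be a smooth global-in-time solution of (∂_t+∂_r+1/r)f = fμ + g whose initial data f|_{t=0} is supported in A_0^R and satisfies ‖f|_{t=0}‖_{C^M} ≤ ε, where μ,g are C^M functions with g supported in A^R and (1+r)²|Z^Iμ(t,x)|+(1+r)³|Z^Ig(t,x)| ≤ ε for all (t,x) and all multi-indices |I|≤M. Then for every product Ω^J of at most M spatial rotations Ω_{12},Ω_{13},Ω_{23}, one has |Ω^Jf(t,x)| ≤ Cε/(1+r) for all (t,x). -/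
noncomputable section

open Real MeasureTheory

/-- Generator of a spatial rotation. -/
def rotA (i j : Fin 3) : Spc →L[ℝ] Spc :=
  (ContinuousLinearMap.proj (R := ℝ) (φ := fun _ : Fin 3 => ℝ) i).smulRight (Pi.single j (1:ℝ) : Spc)
  - (ContinuousLinearMap.proj (R := ℝ) (φ := fun _ : Fin 3 => ℝ) j).smulRight (Pi.single i (1:ℝ) : Spc)

lemma rotA_apply (i j : Fin 3) (x : Spc) :
    rotA i j x = x i • (Pi.single j (1:ℝ) : Spc) - x j • (Pi.single i (1:ℝ) : Spc) := by
  simp [rotA]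

lemma sum_rotA (i j : Fin 3) (x : Spc) : ∑ k, x k * rotA i j x k = 0 := by
  simp only [rotA_apply, Pi.sub_apply, Pi.smul_apply, smul_eq_mul, mul_sub, Finset.sum_sub_distrib]
  simp [Pi.single_apply]
  ring

lemma rad_nonneg (x : Spc) : 0 ≤ rad x := Real.sqrt_nonneg _

lemma rad_sq (x : Spc) : rad x ^ 2 = ∑ i, x i ^ 2 :=
  Real.sq_sqrt (Finset.sum_nonneg fun _ _ => sq_nonneg _)

lemma rad_pos {x : Spc} (hx : x ≠ 0) : 0 < rad x := by
  apply Real.sqrt_pos.2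
  obtain ⟨i, hi⟩ := Function.ne_iff.1 hx
  exact Finset.sum_pos' (fun _ _ => sq_nonneg _) ⟨i, Finset.mem_univ _, by
    have : x i ≠ 0 := hi
    positivity⟩

lemma rad_zero : rad 0 = 0 := by simp [rad]

lemma rad_smul {c : ℝ} (hc : 0 ≤ c) (x : Spc) : rad (c • x) = c * rad x := by
  unfold rad
  simp only [Pi.smul_apply, smul_eq_mul, mul_pow, ← Finset.mul_sum]
  rw [Real.sqrt_mul (sq_nonneg c), Real.sqrt_sq hc]

lemma continuous_rad : Continuous rad := by
  unfold rad
  fun_prop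

lemma abs_le_rad (x : Spc) (i : Fin 3) : |x i| ≤ rad x := by
  apply Real.abs_le_sqrt
  exact Finset.single_le_sum (f := fun i => x i ^ 2) (fun i _ => sq_nonneg _) (Finset.mem_univ i)

lemma norm_le_rad (x : Spc) : ‖x‖ ≤ rad x :=
  (pi_norm_le_iff_of_nonneg (rad_nonneg x)).2 fun i => by simpa using abs_le_rad x i

lemma pxd_slice {u : Pt → ℝ} {t : ℝ} {x : Spc} (i : Fin 3)
    (hu : DifferentiableAt ℝ (fun y => u (t, y)) x) :
    pxd i u (t, x) = fderiv ℝ (fun y => u (t, y)) x (Pi.single i 1) := by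
  have h1 := hasDerivAt_update x i (x i)
  have h2 : HasFDerivAt (fun y => u (t, y)) (fderiv ℝ (fun y => u (t, y)) x)
      (Function.update x i (x i)) := by
    rw [Function.update_eq_self]; exact hu.hasFDerivAt
  exact (h2.comp_hasDerivAt (x i) h1).deriv

lemma vfRot_slice {u : Pt → ℝ} {t : ℝ} {x : Spc} (i j : Fin 3)
    (hu : DifferentiableAt ℝ (fun y => u (t, y)) x) :
    vfRot i j u (t, x) = fderiv ℝ (fun y => u (t, y)) x (rotA i j x) := by
  simp only [vfRot, pxd_slice i hu, pxd_slice j hu, rotA_apply, map_sub, map_smul, smul_eq_mul]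

lemma hasFDerivAt_slice {u : Pt → ℝ} {t : ℝ} {x : Spc} (hu : DifferentiableAt ℝ u (t, x)) :
    HasFDerivAt (fun y => u (t, y)) ((fderiv ℝ u (t, x)).comp (ContinuousLinearMap.inr ℝ ℝ Spc)) x :=
  hu.hasFDerivAt.comp x (hasFDerivAt_prodMk_right t x)

lemma pxd_eq {u : Pt → ℝ} {p : Pt} (i : Fin 3) (hu : DifferentiableAt ℝ u p) :
    pxd i u p = fderiv ℝ u p (0, Pi.single i 1) := by
  obtain ⟨t, x⟩ := p
  have h := hasFDerivAt_slice hu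
  rw [pxd_slice i h.differentiableAt, h.fderiv]
  simp

lemma vfRot_eq {u : Pt → ℝ} {p : Pt} (i j : Fin 3) (hu : DifferentiableAt ℝ u p) :
    vfRot i j u p = fderiv ℝ u p (0, rotA i j p.2) := by
  obtain ⟨t, x⟩ := p
  have h := hasFDerivAt_slice hu
  rw [vfRot_slice i j h.differentiableAt, h.fderiv]
  simp

lemma ptd_eq {u : Pt → ℝ} {p : Pt} (hu : DifferentiableAt ℝ u p) :
    ptd u p = fderiv ℝ u p (1, 0) := by
  obtain ⟨t, x⟩ := p
  have h := (hu.hasFDerivAt.comp t (hasFDerivAt_prodMk_left t x)).hasDerivAt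
  simpa [ptd, Function.comp_def] using h.deriv

lemma vfRot_eq_fun {u : Pt → ℝ} (i j : Fin 3) (hu : Differentiable ℝ u) :
    vfRot i j u = fun p => fderiv ℝ u p (0, rotA i j p.2) :=
  funext fun p => vfRot_eq i j (hu p)

lemma vfRot_contDiff {u : Pt → ℝ} {n : WithTop ℕ∞} (i j : Fin 3) (hu : ContDiff ℝ (n + 1) u) :
    ContDiff ℝ n (vfRot i j u) := by
  rw [vfRot_eq_fun i j (hu.differentiable (by simp))]
  refine (hu.fderiv_right le_rfl).clm_apply ?_
  fun_prop

lemma vfRot_add {u v : Pt → ℝ} (i j : Fin 3) (hu : Differentiable ℝ u) (hv : Differentiable ℝ v) :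
    vfRot i j (fun p => u p + v p) = fun p => vfRot i j u p + vfRot i j v p := by
  funext p
  rw [vfRot_eq i j (hu p), vfRot_eq i j (hv p), vfRot_eq i j ((hu p).fun_add (hv p)),
    fderiv_fun_add (hu p) (hv p)]
  rfl

lemma vfRot_mul {u v : Pt → ℝ} (i j : Fin 3) (hu : Differentiable ℝ u) (hv : Differentiable ℝ v) :
    vfRot i j (fun p => u p * v p) = fun p => vfRot i j u p * v p + u p * vfRot i j v p := by
  funext p
  rw [vfRot_eq i j (hu p), vfRot_eq i j (hv p), vfRot_eq i j ((hu p).fun_mul (hv p)),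
    fderiv_fun_mul (hu p) (hv p)]
  simp
  ring

/-- Locality. -/
lemma vfRot_zero_of_open {u : Pt → ℝ} {t : ℝ} {U : Set Spc} (hU : IsOpen U) (i j : Fin 3)
    (h : ∀ x ∈ U, u (t, x) = 0) : ∀ x ∈ U, vfRot i j u (t, x) = 0 := by
  intro x hx
  have he : (fun y => u (t, y)) =ᶠ[nhds x] fun _ => 0 := by
    filter_upwards [hU.mem_nhds hx] with y hy using h y hy
  have hd : DifferentiableAt ℝ (fun y => u (t, y)) x :=
    (differentiableAt_const (0:ℝ)).congr_of_eventuallyEq he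
  rw [vfRot_slice i j hd, he.fderiv_eq]
  simp

lemma applyOps_nil (u : Pt → ℝ) : applyOps [] u = u := rfl

lemma applyOps_cons (Z : Op) (L : List Op) (u : Pt → ℝ) :
    applyOps (Z :: L) u = Z (applyOps L u) := rfl

lemma rotMulti_cons {Z : Op} {L : List Op} (h : IsRotMulti (Z :: L)) :
    (∃ i j, Z = vfRot i j) ∧ IsRotMulti L := by
  refine ⟨?_, fun Y hY => h Y (List.mem_cons_of_mem _ hY)⟩
  rcases h Z (List.mem_cons_self) with h | h | h
  exacts [⟨_, _, h⟩, ⟨_, _, h⟩, ⟨_, _, h⟩]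

lemma rotMulti_isMulti {L : List Op} (h : IsRotMulti L) : IsMulti L := by
  intro Z hZ
  rcases h Z hZ with h | h | h
  exacts [⟨8, h⟩, ⟨9, h⟩, ⟨10, h⟩]

lemma applyOps_zero_of_open {u : Pt → ℝ} {t : ℝ} {U : Set Spc} (hU : IsOpen U)
    (h : ∀ x ∈ U, u (t, x) = 0) : ∀ L : List Op, IsRotMulti L →
    ∀ x ∈ U, applyOps L u (t, x) = 0
  | [], _ => h
  | Z :: L, hL => by
    obtain ⟨⟨i, j, rfl⟩, hL'⟩ := rotMulti_cons hL
    exact vfRot_zero_of_open hU i j (applyOps_zero_of_open hU h L hL')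

lemma applyOps_contDiff {u : Pt → ℝ} {n : ℕ} : ∀ L : List Op, IsRotMulti L →
    ∀ k : ℕ, L.length + k ≤ n → ContDiff ℝ n u → ContDiff ℝ k (applyOps L u)
  | [], _, k, hk, hu => hu.of_le (by simp at hk; exact_mod_cast hk)
  | Z :: L, hL, k, hk, hu => by
    obtain ⟨⟨i, j, rfl⟩, hL'⟩ := rotMulti_cons hL
    apply vfRot_contDiff
    have := applyOps_contDiff L hL' (k + 1) (by simp at hk; omega) hu
    exact_mod_cast this

lemma applyOps_smooth {u : Pt → ℝ} (hu : ContDiff ℝ (⊤ : ℕ∞) u) (L : List Op)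
    (hL : IsRotMulti L) : ContDiff ℝ (⊤ : ℕ∞) (applyOps L u) := by
  rw [contDiff_infty] at hu ⊢
  exact fun n => applyOps_contDiff L hL n le_rfl (hu _)

lemma applyOps_add {u v : Pt → ℝ} {n : ℕ} (hu : ContDiff ℝ n u) (hv : ContDiff ℝ n v) :
    ∀ L : List Op, IsRotMulti L → L.length ≤ n →
    applyOps L (fun p => u p + v p) = fun p => applyOps L u p + applyOps L v p
  | [], _, _ => rfl
  | Z :: L, hL, hn => by
    obtain ⟨⟨i, j, rfl⟩, hL'⟩ := rotMulti_cons hL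
    simp at hn
    rw [applyOps_cons, applyOps_add hu hv L hL' (by omega), applyOps_cons, applyOps_cons]
    exact vfRot_add i j ((applyOps_contDiff L hL' 1 hn hu).differentiable (by simp))
      ((applyOps_contDiff L hL' 1 hn hv).differentiable (by simp))

lemma vfRot_listsum {ι : Type} (F : ι → Pt → ℝ) (i j : Fin 3) : ∀ S : List ι,
    (∀ a ∈ S, Differentiable ℝ (F a)) →
    Differentiable ℝ (fun p => (S.map fun a => F a p).sum) ∧
    vfRot i j (fun p => (S.map fun a => F a p).sum) = fun p => (S.map fun a => vfRot i j (F a) p).sum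
  | [], _ => by
    refine ⟨by simp, ?_⟩
    funext p
    rw [vfRot_eq i j (by simp)]
    simp
  | a :: S, h => by
    obtain ⟨h1, h2⟩ := vfRot_listsum F i j S (fun b hb => h b (List.mem_cons_of_mem _ hb))
    have ha := h a List.mem_cons_self
    simp only [List.map_cons, List.sum_cons]
    refine ⟨ha.add h1, ?_⟩
    rw [vfRot_add i j ha h1, h2]

lemma sum_double {ι : Type} (G H : ι → ℝ) : ∀ S : List ι,
    (S.map fun a => G a + H a).sum = (S.map G).sum + (S.map H).sum
  | [] => by simp
  | a :: S => by simp [sum_double G H S]; ring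

/-- Leibniz rule. -/
lemma applyOps_mul {u v : Pt → ℝ} {n : ℕ} (hu : ContDiff ℝ n u) (hv : ContDiff ℝ n v) :
    ∀ L : List Op, IsRotMulti L → L.length ≤ n →
    ∃ S : List (List Op × List Op), S.length + 1 ≤ 2 ^ L.length ∧
      (∀ a ∈ S, IsRotMulti a.1 ∧ IsRotMulti a.2 ∧ a.1.length < L.length ∧ a.2.length ≤ L.length) ∧
    applyOps L (fun p => u p * v p) = fun p => applyOps L u p * v p +
      (S.map fun a => applyOps a.1 u p * applyOps a.2 v p).sum
  | [], _, _ => ⟨[], by simp, by simp, by simp [applyOps_nil]⟩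
  | Z :: L, hL, hn => by
    obtain ⟨⟨i, j, rfl⟩, hL'⟩ := rotMulti_cons hL
    have hZ := hL (vfRot i j) List.mem_cons_self
    simp at hn
    obtain ⟨S, hS1, hS2, hS3⟩ := applyOps_mul hu hv L hL' (by omega)
    have hc : ∀ A : List Op, IsRotMulti A → IsRotMulti (vfRot i j :: A) := by
      intro A hA Y hY
      rcases List.mem_cons.1 hY with rfl | hY
      exacts [hZ, hA Y hY]
    have du : ∀ A : List Op, IsRotMulti A → A.length ≤ L.length →
        Differentiable ℝ (applyOps A u) := fun A hA hl =>
      (applyOps_contDiff A hA 1 (by omega) hu).differentiable (by simp)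
    have dv : ∀ A : List Op, IsRotMulti A → A.length ≤ L.length →
        Differentiable ℝ (applyOps A v) := fun A hA hl =>
      (applyOps_contDiff A hA 1 (by omega) hv).differentiable (by simp)
    have dF : ∀ a ∈ S, Differentiable ℝ (fun p => applyOps a.1 u p * applyOps a.2 v p) := by
      intro a ha
      obtain ⟨h1, h2, h3, h4⟩ := hS2 a ha
      exact (du _ h1 h3.le).mul (dv _ h2 h4)
    obtain ⟨d1, e1⟩ := vfRot_listsum (fun a p => applyOps a.1 u p * applyOps a.2 v p) i j S dF
    have dvv : Differentiable ℝ v := dv [] (by simp [IsRotMulti]) (by simp)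
    refine ⟨(L, [vfRot i j]) :: (S.map (fun a => (vfRot i j :: a.1, a.2)) ++
      S.map (fun a => (a.1, vfRot i j :: a.2))), ?_, ?_, ?_⟩
    · simp [pow_succ]
      omega
    · intro a ha
      simp only [List.mem_cons, List.mem_append, List.mem_map] at ha
      rcases ha with rfl | ⟨b, hb, rfl⟩ | ⟨b, hb, rfl⟩
      · exact ⟨hL', hc [] (by simp [IsRotMulti]), by simp, by simp⟩
      · obtain ⟨h1, h2, h3, h4⟩ := hS2 b hb
        exact ⟨hc _ h1, h2, by simp; omega, by simp; omega⟩
      · obtain ⟨h1, h2, h3, h4⟩ := hS2 b hb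
        exact ⟨h1, hc _ h2, by simp; omega, by simp; omega⟩
    · rw [applyOps_cons, hS3, vfRot_add i j ((du L hL' le_rfl).fun_mul dvv) d1, e1,
        vfRot_mul i j (du L hL' le_rfl) dvv]
      funext p
      have : (S.map fun a => vfRot i j (fun p => applyOps a.1 u p * applyOps a.2 v p) p) =
          S.map fun a => applyOps (vfRot i j :: a.1) u p * applyOps a.2 v p
            + applyOps a.1 u p * applyOps (vfRot i j :: a.2) v p := by
        apply List.map_congr_left
        intro a ha
        obtain ⟨h1, h2, h3, h4⟩ := hS2 a ha
        rw [vfRot_mul i j (du _ h1 h3.le) (dv _ h2 h4)]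
        rfl
      beta_reduce
      rw [this, sum_double]
      simp [applyOps_cons, applyOps_nil, Function.comp_def]
      ring

/-- The rescaled transport operator r(∂_t + ∂_r) + 1. -/
def eul (u : Pt → ℝ) (p : Pt) : ℝ := fderiv ℝ u p (rad p.2, p.2) + u p

lemma eul_of_eq {u : Pt → ℝ} {p : Pt} {w : ℝ} (hu : DifferentiableAt ℝ u p) (hp : p.2 ≠ 0)
    (h : ptd u p + prd u p + u p / rad p.2 = w) : eul u p = rad p.2 * w := by
  have hr := (rad_pos hp).ne'
  rw [← h, ptd_eq hu]
  simp only [prd, pxd_eq _ hu]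
  have e : ((rad p.2, p.2) : Pt) = rad p.2 • ((1, 0) : Pt) + ∑ i, p.2 i • ((0, Pi.single i 1) : Pt) := by
    ext k
    · simp [Prod.fst_sum]
    · simp [Prod.snd_sum, Pi.single_apply]
  unfold eul
  rw [e]
  simp only [map_add, map_smul, smul_eq_mul, Fin.sum_univ_three]
  field_simp

lemma hasDerivAt_rad_rot (i j : Fin 3) {x : Spc} (hx : x ≠ 0) :
    HasDerivAt (fun s : ℝ => rad (x + s • rotA i j x)) 0 0 := by
  have hpos : (∑ k, (x + (0:ℝ) • rotA i j x) k ^ 2) ≠ 0 := by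
    simp only [zero_smul, add_zero]
    rw [← rad_sq]
    exact pow_ne_zero _ (rad_pos hx).ne'
  have h1 : HasDerivAt (fun s : ℝ => ∑ k, (x + s • rotA i j x) k ^ 2)
      (∑ k, 2 * (x k * rotA i j x k)) 0 := by
    apply HasDerivAt.fun_sum
    intro k _
    have : HasDerivAt (fun s : ℝ => (x + s • rotA i j x) k) (rotA i j x k) 0 := by
      simpa using ((hasDerivAt_id (0:ℝ)).mul_const (rotA i j x k)).const_add (x k)
    refine (this.fun_pow 2).congr_deriv ?_
    simp
    ring
  have := h1.sqrt hpos
  rw [← Finset.mul_sum, sum_rotA] at this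
  simpa [rad] using this

lemma eul_comm {u v : Pt → ℝ} (i j : Fin 3) (hu : ContDiff ℝ 2 u) (hv : Differentiable ℝ v)
    {t : ℝ} (h : ∀ x : Spc, x ≠ 0 → eul u (t, x) = rad x * v (t, x)) :
    ∀ x : Spc, x ≠ 0 → eul (vfRot i j u) (t, x) = rad x * vfRot i j v (t, x) := by
  intro x hx
  have du : Differentiable ℝ u := hu.differentiable (by simp)
  have d2u : Differentiable ℝ (fderiv ℝ u) :=
    (hu.fderiv_right (m := 1) (by norm_num)).differentiable (by simp)
  set A := rotA i j with hA
  have hy : HasDerivAt (fun s : ℝ => x + s • A x) (A x) 0 := by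
    simpa using ((hasDerivAt_id (0:ℝ)).smul_const (A x)).const_add x
  have hg : HasDerivAt (fun s : ℝ => ((t, x + s • A x) : Pt)) (0, A x) 0 :=
    (hasDerivAt_const _ _).prodMk hy
  have hw : HasDerivAt (fun s : ℝ => ((rad (x + s • A x), x + s • A x) : Pt)) (0, A x) 0 :=
    (hasDerivAt_rad_rot i j hx).prodMk hy
  have g0 : ((t, x + (0:ℝ) • A x) : Pt) = (t, x) := by simp
  have hcomp : ∀ (w : Pt → ℝ), Differentiable ℝ w →
      HasDerivAt (fun s : ℝ => w (t, x + s • A x)) (fderiv ℝ w (t, x) (0, A x)) 0 := by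
    intro w hw
    have h1 : HasFDerivAt w (fderiv ℝ w (t, x)) (t, x + (0:ℝ) • A x) := by
      rw [g0]; exact (hw _).hasFDerivAt
    exact h1.comp_hasDerivAt (0:ℝ) hg
  have hcomp2 : HasDerivAt (fun s : ℝ => fderiv ℝ u (t, x + s • A x))
      (fderiv ℝ (fderiv ℝ u) (t, x) (0, A x)) 0 := by
    have h1 : HasFDerivAt (fderiv ℝ u) (fderiv ℝ (fderiv ℝ u) (t, x)) (t, x + (0:ℝ) • A x) := by
      rw [g0]; exact (d2u _).hasFDerivAt
    exact h1.comp_hasDerivAt (0:ℝ) hg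
  have hl : HasDerivAt (fun s : ℝ => eul u (t, x + s • A x))
      (fderiv ℝ (fderiv ℝ u) (t, x) (0, A x) (rad x, x) + fderiv ℝ u (t, x) (0, A x)
        + fderiv ℝ u (t, x) (0, A x)) 0 := by
    have := (hcomp2.clm_apply hw).fun_add (hcomp u du)
    simpa [eul] using this
  have hr : HasDerivAt (fun s : ℝ => rad (x + s • A x) * v (t, x + s • A x))
      (rad x * fderiv ℝ v (t, x) (0, A x)) 0 := by
    have := (hasDerivAt_rad_rot i j hx).fun_mul (hcomp v hv)
    simpa using this
  have he : (fun s : ℝ => eul u (t, x + s • A x)) =ᶠ[nhds 0]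
      (fun s : ℝ => rad (x + s • A x) * v (t, x + s • A x)) := by
    have : ∀ᶠ s : ℝ in nhds 0, x + s • A x ≠ 0 := by
      apply hy.continuousAt.eventually_ne
      simpa using hx
    filter_upwards [this] with s hs using h _ hs
  have key := (hl.congr_of_eventuallyEq he.symm).unique hr
  rw [vfRot_eq i j (hv _), ← key]
  have hz := (d2u (t, x)).hasFDerivAt.clm_apply
      (((0 : Pt →L[ℝ] ℝ).prod (A.comp (ContinuousLinearMap.snd ℝ ℝ Spc))).hasFDerivAt (x := (t, x)))
  have hz' : vfRot i j u = fun y => fderiv ℝ u y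
      (((0 : Pt →L[ℝ] ℝ).prod (A.comp (ContinuousLinearMap.snd ℝ ℝ Spc))) y) := by
    rw [vfRot_eq_fun i j du]
    rfl
  rw [← hz'] at hz
  unfold eul
  rw [hz.fderiv, vfRot_eq i j (du _)]
  have sym := (hu.contDiffAt (x := (t, x))).isSymmSndFDerivAt (by simp)
  have := sym (0, A x) (rad x, x)
  simp [← hA]
  rw [this]
  ring

lemma eul_applyOps {u v : Pt → ℝ} {n : ℕ} (hu : ContDiff ℝ (⊤ : ℕ∞) u) (hv : ContDiff ℝ n v)
    {t : ℝ} (h : ∀ x : Spc, x ≠ 0 → eul u (t, x) = rad x * v (t, x)) :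
    ∀ L : List Op, IsRotMulti L → L.length ≤ n →
    ∀ x : Spc, x ≠ 0 → eul (applyOps L u) (t, x) = rad x * applyOps L v (t, x)
  | [], _, _ => h
  | Z :: L, hL, hn => by
    obtain ⟨⟨i, j, rfl⟩, hL'⟩ := rotMulti_cons hL
    simp at hn
    exact eul_comm i j ((applyOps_smooth hu L hL').of_le (by norm_cast))
      ((applyOps_contDiff L hL' 1 hn hv).differentiable (by simp))
      (eul_applyOps hu hv h L hL' (by omega))

/-- Comparison for the transport ODE. -/
lemma ode_bound {h h' : ℝ → ℝ} {a b c D K : ℝ} (hab : a ≤ b) (hc : 0 ≤ c + a)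
    (hd : ∀ s, a ≤ s → HasDerivAt h (h' s) s) (ha : |h a| < D) (hKD : K ≤ D / 2)
    (hb : ∀ s ∈ Set.Ioo a b, |h' s| ≤ (1 / 8 * |h s| + K) / (1 + (c + s)) ^ 2) :
    |h b| ≤ 2 * D := by
  have hD : 0 < D := (abs_nonneg _).trans_lt ha
  have pos : ∀ s, a ≤ s → 0 < 1 + (c + s) := fun s hs => by linarith
  have hB : ∀ s, a ≤ s → HasDerivAt (fun s => D * (2 - (1 + (c + s))⁻¹)) (D / (1 + (c + s)) ^ 2) s := by
    intro s hs
    have h1 : HasDerivAt (fun s : ℝ => 1 + (c + s)) 1 s := ((hasDerivAt_id s).const_add c).const_add 1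
    have h2 := ((h1.fun_inv (pos s hs).ne').const_sub 2).const_mul D
    refine h2.congr_deriv ?_
    rw [neg_div, neg_neg, mul_one_div]
  have le1 : ∀ s, a ≤ s → (1 + (c + s))⁻¹ ≤ 1 := fun s hs => inv_le_one_of_one_le₀ (by linarith)
  have le0 : ∀ s, a ≤ s → 0 < (1 + (c + s))⁻¹ := fun s hs => inv_pos.2 (pos s hs)
  have key := image_norm_le_of_norm_deriv_right_lt_deriv_boundary' (f := h) (f' := h') (a := a) (b := b)
    (B := fun s => D * (2 - (1 + (c + s))⁻¹)) (B' := fun s => D / (1 + (c + s)) ^ 2)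
    (fun s hs => (hd s hs.1).continuousAt.continuousWithinAt)
    (fun s hs => (hd s hs.1).hasDerivWithinAt)
    (by
      rw [Real.norm_eq_abs]
      nlinarith [le1 a le_rfl])
    (fun s hs => (hB s hs.1).continuousAt.continuousWithinAt)
    (fun s hs => (hB s hs.1).hasDerivWithinAt)
    (by
      intro s hs he
      simp only [Real.norm_eq_abs] at he ⊢
      rcases hs.1.eq_or_lt with rfl | hlt
      · exfalso
        nlinarith [le1 a le_rfl]
      · refine (hb s ⟨hlt, hs.2⟩).trans_lt ?_
        have := pos s hs.1
        gcongr
        nlinarith [le0 s hs.1])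
    (Set.right_mem_Icc.2 hab)
  rw [Real.norm_eq_abs] at key
  refine key.trans ?_
  nlinarith [le0 b hab]

/-- Integration along outgoing null rays. -/
lemma transport_bound {u : Pt → ℝ} (hu : Differentiable ℝ u) {t a : ℝ} {x : Spc} (hx : x ≠ 0)
    {D K : ℝ} (hat : a ≤ t) (ha : 0 ≤ rad x - t + a) (hKD : K ≤ D / 2)
    (h0 : |(rad x - t + a) * u (a, ((rad x - t + a) / rad x) • x)| < D)
    (hb : ∀ s ∈ Set.Ioo a t, |eul u (s, ((rad x - t + s) / rad x) • x)| ≤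
      (1 / 8 * |(rad x - t + s) * u (s, ((rad x - t + s) / rad x) • x)| + K)
        / (1 + (rad x - t + s)) ^ 2) :
    rad x * |u (t, x)| ≤ 2 * D := by
  have hr := rad_pos hx
  have := ode_bound (h := fun s => (rad x - t + s) * u (s, ((rad x - t + s) / rad x) • x))
    (h' := fun s => eul u (s, ((rad x - t + s) / rad x) • x)) (c := rad x - t) hat ha ?_ h0 hKD hb
  · simpa [abs_mul, abs_of_pos hr, hr.ne'] using this
  · intro s hs
    have hρ : 0 ≤ rad x - t + s := by linarith
    have h1 : HasDerivAt (fun s => rad x - t + s) 1 s := (hasDerivAt_id s).const_add _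
    have h2 : HasDerivAt (fun s : ℝ => ((s, ((rad x - t + s) / rad x) • x) : Pt))
        (1, (1 / rad x) • x) s := (hasDerivAt_id s).prodMk ((h1.div_const _).smul_const x)
    have h3 := h1.fun_mul ((hu _).hasFDerivAt.comp_hasDerivAt s h2)
    refine h3.congr_deriv ?_
    simp only [eul, Function.comp_def]
    rw [rad_smul (by positivity), div_mul_cancel₀ _ hr.ne']
    have : ((rad x - t + s, ((rad x - t + s) / rad x) • x) : Pt)
      = (rad x - t + s) • ((1, (1 / rad x) • x) : Pt) := by
      simp [smul_smul, div_eq_mul_inv]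
    rw [this, map_smul, smul_eq_mul]
    ring

lemma vfRot_slice_bound {M : ℕ} {R : ℝ} : ∃ B : ℝ, 0 ≤ B ∧ ∀ i j : Fin 3, ∀ m ≤ M, ∀ x : Spc, rad x ≤ R →
    ‖iteratedFDeriv ℝ m (fun y => rotA i j y) x‖ ≤ B := by
  have h : ∀ i j : Fin 3, ∀ m : ℕ, ∃ B : ℝ, 0 ≤ B ∧ ∀ x ∈ Metric.closedBall (0 : Spc) R,
      ‖iteratedFDeriv ℝ m (fun y => rotA i j y) x‖ ≤ B := by
    intro i j m
    have hc : Continuous (iteratedFDeriv ℝ m (fun y => rotA i j y)) :=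
      ((rotA i j).contDiff (n := (m : ℕ∞))).continuous_iteratedFDeriv (by simp)
    obtain ⟨B, hB⟩ := (isCompact_closedBall (0 : Spc) R).exists_bound_of_continuousOn hc.continuousOn
    exact ⟨max B 0, le_max_right _ _, fun x hx => (hB x hx).trans (le_max_left _ _)⟩
  choose B hB0 hB using h
  refine ⟨∑ i, ∑ j, ∑ m ∈ Finset.range (M + 1), B i j m,
    Finset.sum_nonneg fun i _ => Finset.sum_nonneg fun j _ => Finset.sum_nonneg fun m _ => hB0 _ _ _, ?_⟩
  intro i j m hm x hx
  refine (hB i j m x (by simpa using (norm_le_rad x).trans hx)).trans ?_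
  calc B i j m ≤ ∑ m ∈ Finset.range (M + 1), B i j m :=
        Finset.single_le_sum (f := fun m => B i j m) (fun m _ => hB0 _ _ _) (Finset.mem_range.2 (by omega))
    _ ≤ ∑ j, ∑ m ∈ Finset.range (M + 1), B i j m :=
        Finset.single_le_sum (f := fun j => ∑ m ∈ Finset.range (M + 1), B i j m)
          (fun j _ => Finset.sum_nonneg fun m _ => hB0 _ _ _) (Finset.mem_univ _)
    _ ≤ _ := Finset.single_le_sum (f := fun i => ∑ j, ∑ m ∈ Finset.range (M + 1), B i j m)
          (fun i _ => Finset.sum_nonneg fun j _ => Finset.sum_nonneg fun m _ => hB0 _ _ _)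
          (Finset.mem_univ _)

lemma data_bound (M : ℕ) (R : ℝ) : ∀ n : ℕ, ∃ K : ℝ, 0 < K ∧ ∀ ε : ℝ, 0 < ε → ∀ f : Pt → ℝ,
    ContDiff ℝ (⊤ : ℕ∞) f → CMBound M (fun x => f (0, x)) ε →
    ∀ L : List Op, IsRotMulti L → L.length ≤ n → ∀ k, k + L.length ≤ M → ∀ x, rad x ≤ R →
      ‖iteratedFDeriv ℝ k (fun x => applyOps L f (0, x)) x‖ ≤ K * ε := by
  obtain ⟨B, hB0, hB⟩ := vfRot_slice_bound (M := M) (R := R)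
  intro n
  induction n with
  | zero =>
    refine ⟨1, one_pos, fun ε _ f _ hCM L _ hn k hk x _ => ?_⟩
    obtain rfl : L = [] := by simpa using hn
    simpa [applyOps_nil] using hCM k (by simpa using hk) x
  | succ n ih =>
    obtain ⟨K, hK, ih⟩ := ih
    refine ⟨K + 2 ^ M * K * B, by positivity, fun ε hε f hf hCM L hL hn k hk x hx => ?_⟩
    rcases L with _ | ⟨Z, L⟩
    · refine (ih ε hε f hf hCM [] hL (by simp) k hk x hx).trans ?_
      gcongr
      have : 0 ≤ 2 ^ M * K * B := by positivity
      linarith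
    · obtain ⟨⟨i, j, rfl⟩, hL'⟩ := rotMulti_cons hL
      simp only [List.length_cons] at hn hk
      have sm : ContDiff ℝ (⊤ : ℕ∞) (fun x => applyOps L f (0, x)) :=
        (applyOps_smooth hf L hL').comp (by fun_prop)
      have e : (fun x => applyOps (vfRot i j :: L) f (0, x)) =
          fun x => fderiv ℝ (fun x => applyOps L f (0, x)) x (rotA i j x) := by
        funext y
        exact vfRot_slice i j (sm.differentiable (by simp) y)
      rw [e]
      refine (norm_iteratedFDeriv_clm_apply (N := (⊤ : ℕ∞))
        (sm.fderiv_right (m := (⊤ : ℕ∞)) (by simp)) (rotA i j).contDiff x (by exact_mod_cast le_top)).trans ?_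
      have : ∀ m ∈ Finset.range (k + 1), (k.choose m : ℝ) *
          ‖iteratedFDeriv ℝ m (fderiv ℝ (fun x => applyOps L f (0, x))) x‖ *
          ‖iteratedFDeriv ℝ (k - m) (fun y => rotA i j y) x‖ ≤ (k.choose m : ℝ) * (K * ε * B) := by
        intro m hm
        have hm' := Finset.mem_range.1 hm
        rw [norm_iteratedFDeriv_fderiv, mul_assoc]
        gcongr
        · exact ih ε hε f hf hCM L hL' (by omega) (m + 1) (by omega) x hx
        · exact hB i j (k - m) (by omega) x hx
      refine (Finset.sum_le_sum this).trans ?_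
      rw [← Finset.sum_mul]
      have hs : (∑ m ∈ Finset.range (k + 1), (k.choose m : ℝ)) = 2 ^ k := by
        exact_mod_cast Nat.sum_range_choose k
      rw [hs]
      have h2 : (2:ℝ) ^ k ≤ 2 ^ M := pow_le_pow_right₀ (by norm_num) (by omega)
      calc (2:ℝ) ^ k * (K * ε * B) ≤ 2 ^ M * (K * ε * B) := by gcongr
        _ ≤ (K + 2 ^ M * K * B) * ε := by nlinarith [mul_pos hK hε]

lemma char_rad {x : Spc} (hx : x ≠ 0) {ρ : ℝ} (hρ : 0 ≤ ρ) : rad ((ρ / rad x) • x) = ρ := by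
  have := rad_pos hx
  rw [rad_smul (by positivity), div_mul_cancel₀ _ this.ne']

lemma char_ne {x : Spc} (hx : x ≠ 0) {ρ : ℝ} (hρ : 0 < ρ) : (ρ / rad x) • x ≠ 0 := by
  have := rad_pos hx
  exact smul_ne_zero (by positivity) hx

/-- The solution is supported in `regA R`. -/
lemma supp_f {R : ℝ} (hR : 0 < R) {f μ g : Pt → ℝ} (hf : Differentiable ℝ f)
    (he : ∀ t : ℝ, 0 ≤ t → ∀ x : Spc, x ≠ 0 →
      eul f (t, x) = rad x * (f (t, x) * μ (t, x) + g (t, x)))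
    (h0 : ∀ x, x ∉ regA0 R → f (0, x) = 0)
    (hg : ∀ p : Pt, 0 ≤ p.1 → p ∉ regA R → g p = 0)
    (hμ : ∀ p : Pt, 0 ≤ p.1 → (1 + rad p.2) ^ 2 * |μ p| ≤ 1 / 8) :
    ∀ t : ℝ, 0 ≤ t → ∀ x : Spc, (t, x) ∉ regA R → f (t, x) = 0 := by
  have main : ∀ t : ℝ, 0 ≤ t → ∀ x : Spc, x ≠ 0 → (t, x) ∉ regA R → f (t, x) = 0 := by
    intro t ht x hx hA
    have hr := rad_pos hx
    have nA : ∀ s, 0 ≤ rad x - t + s → (s, ((rad x - t + s) / rad x) • x) ∉ regA R := by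
      intro s hs h
      apply hA
      simp only [regA, Set.mem_ofPred_eq, char_rad hx hs] at h ⊢
      constructor <;> linarith [h.1, h.2]
    have key : ∀ D : ℝ, 0 < D → rad x * |f (t, x)| ≤ 2 * D := by
      intro D hD
      have ha0 : 0 ≤ rad x - t + max 0 (t - rad x) := by linarith [le_max_right 0 (t - rad x)]
      refine transport_bound hf (a := max 0 (t - rad x)) (K := 0) hx (max_le ht (by linarith))
        ha0 (by positivity) ?_ ?_
      · rcases le_total (t - rad x) 0 with h | h
        · rw [max_eq_left h]
          rw [h0 _ ?_]
          · simpa using hD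
          · intro h'
            rw [max_eq_left h] at ha0
            apply nA 0 ha0
            simpa [regA, regA0] using h'
        · rw [max_eq_right h]
          simpa using hD
      · intro s hs
        have hs0 : 0 ≤ s := (le_max_left _ _).trans hs.1.le
        have hρ : 0 < rad x - t + s := by linarith [(le_max_right 0 (t - rad x)).trans_lt hs.1]
        rw [he s hs0 _ (char_ne hx hρ), hg _ hs0 (nA s hρ.le), add_zero, char_rad hx hρ.le]
        have hm := hμ (s, ((rad x - t + s) / rad x) • x) hs0
        simp only [char_rad hx hρ.le] at hm
        rw [le_div_iff₀ (by positivity), ← mul_assoc, abs_mul, add_zero]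
        nlinarith [abs_nonneg ((rad x - t + s) * f (s, ((rad x - t + s) / rad x) • x))]
    by_contra hne
    have hpos : 0 < rad x * |f (t, x)| := by positivity
    have := key _ (by positivity : 0 < rad x * |f (t, x)| / 4)
    linarith
  intro t ht x hA
  by_cases hx : x = 0
  · subst hx
    have hcont : Continuous fun y : Spc => f (t, y) := hf.continuous.comp (by fun_prop)
    have h1 : ∀ᶠ y : Spc in nhds 0, rad y - t < 1 / R := by
      have : Filter.Tendsto (fun y => rad y - t) (nhds 0) (nhds (rad 0 - t)) :=
        (continuous_rad.sub continuous_const).tendsto 0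
      apply this.eventually_lt_const
      rw [rad_zero]
      have : 0 < 1 / R := by positivity
      linarith
    have h2 : ∀ᶠ y : Spc in nhdsWithin 0 {0}ᶜ, f (t, y) = 0 := by
      filter_upwards [h1.filter_mono nhdsWithin_le_nhds, self_mem_nhdsWithin] with y hy hy0
      refine main t ht y hy0 fun h => ?_
      have := h.1
      simp only at this
      linarith
    have h3 : Filter.Tendsto (fun y : Spc => f (t, y)) (nhdsWithin 0 {0}ᶜ) (nhds (f (t, 0))) :=
      (hcont.tendsto 0).mono_left nhdsWithin_le_nhds
    exact tendsto_nhds_unique h3 (tendsto_const_nhds.congr' (h2.mono fun y hy => hy.symm))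
  · exact main t ht x hx hA

lemma abs_listsum_le {ι : Type} (G : ι → ℝ) (X : ℝ) : ∀ S : List ι,
    (∀ a ∈ S, |G a| ≤ X) → |(S.map G).sum| ≤ S.length * X
  | [], _ => by simp
  | a :: S, h => by
    have h1 := abs_listsum_le G X S fun b hb => h b (List.mem_cons_of_mem _ hb)
    have h2 := h a List.mem_cons_self
    simp only [List.map_cons, List.sum_cons, List.length_cons, Nat.cast_add, Nat.cast_one]
    refine (abs_add_le _ _).trans ?_
    linarith

lemma isOpen_compl_slice (R t : ℝ) : IsOpen {x : Spc | (t, x) ∉ regA R} := by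
  have : IsClosed {x : Spc | (t, x) ∈ regA R} := by
    have h1 : IsClosed {x : Spc | 1 / R ≤ rad x - t} :=
      isClosed_le continuous_const (continuous_rad.sub continuous_const)
    have h2 : IsClosed {x : Spc | rad x - t ≤ R} :=
      isClosed_le (continuous_rad.sub continuous_const) continuous_const
    exact h1.inter h2
  exact this.isOpen_compl

lemma main_induction (M : ℕ) (R : ℝ) (hR : 0 < R) (n : ℕ) :
    ∃ C > 0, ∀ ε : ℝ, 0 < ε → ε ≤ 1 / 8 →
      ∀ f μ g : Pt → ℝ, ContDiff ℝ (⊤ : ℕ∞) f → ContDiff ℝ (M : ℕ) μ → ContDiff ℝ (M : ℕ) g →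
        (∀ p : Pt, 0 ≤ p.1 → p.2 ≠ 0 →
          ptd f p + prd f p + f p / rad p.2 = f p * μ p + g p) →
        (∀ x, x ∉ regA0 R → f (0, x) = 0) →
        CMBound M (fun x => f (0, x)) ε →
        (∀ p : Pt, 0 ≤ p.1 → p ∉ regA R → g p = 0) →
        (∀ L : List Op, IsMulti L → L.length ≤ M → ∀ p : Pt, 0 ≤ p.1 →
          (1 + rad p.2) ^ 2 * |applyOps L μ p| + (1 + rad p.2) ^ 3 * |applyOps L g p| ≤ ε) →
        ∀ L : List Op, IsRotMulti L → L.length < n → L.length ≤ M →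
          ∀ p : Pt, 0 ≤ p.1 → |applyOps L f p| ≤ C * ε / (1 + rad p.2) := by
  induction n with
  | zero => exact ⟨1, one_pos, by intros; omega⟩
  | succ n ih =>
    obtain ⟨C, hC, ih⟩ := ih
    obtain ⟨K, hK, hdata⟩ := data_bound M R M
    set Q : ℝ := 2 ^ n * C + 1 with hQ
    have hQ0 : 0 < Q := by positivity
    set D : ℝ := 2 * Q + R * K + 1 with hD
    have hD0 : 0 < D := by positivity
    refine ⟨C + 2 * D * (1 + R), by positivity, ?_⟩
    intro ε hε hε8 f μ g hf hμ hg heq h0 hCM hgA hb L hL hLn hLM p hp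
    have hrp := rad_nonneg p.2
    rcases Nat.lt_succ_iff_lt_or_eq.1 hLn with hlt | hLeq
    · refine (ih ε hε hε8 f μ g hf hμ hg heq h0 hCM hgA hb L hL hlt hLM p hp).trans ?_
      gcongr
      have : 0 ≤ 2 * D * (1 + R) := by positivity
      linarith
    obtain ⟨t, x⟩ := p
    simp only at hp hrp ⊢
    have df : Differentiable ℝ f := hf.differentiable (by simp)
    have fM : ContDiff ℝ M f := hf.of_le (by exact_mod_cast le_top)
    have hμb : ∀ A : List Op, IsRotMulti A → A.length ≤ M → ∀ q : Pt, 0 ≤ q.1 →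
        (1 + rad q.2) ^ 2 * |applyOps A μ q| ≤ ε := by
      intro A hA hAM q hq
      have h1 := hb A (rotMulti_isMulti hA) hAM q hq
      have := rad_nonneg q.2
      have : 0 ≤ (1 + rad q.2) ^ 3 * |applyOps A g q| := by positivity
      linarith
    have hgb : ∀ q : Pt, 0 ≤ q.1 → (1 + rad q.2) ^ 3 * |applyOps L g q| ≤ ε := by
      intro q hq
      have h1 := hb L (rotMulti_isMulti hL) hLM q hq
      have : 0 ≤ (1 + rad q.2) ^ 2 * |applyOps L μ q| := by positivity
      linarith
    have heul : ∀ t : ℝ, 0 ≤ t → ∀ x : Spc, x ≠ 0 →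
        eul f (t, x) = rad x * (f (t, x) * μ (t, x) + g (t, x)) := fun t ht x hx =>
      eul_of_eq (df _) hx (heq (t, x) ht hx)
    have hsupp := supp_f hR df heul h0 hgA
      (fun q hq => (hμb [] (by simp [IsRotMulti]) (by simp) q hq).trans hε8)
    by_cases hA : (t, x) ∉ regA R
    · rw [applyOps_zero_of_open (isOpen_compl_slice R t) (fun y hy => hsupp t hp y hy) L hL x hA]
      simp
      positivity
    push Not at hA
    have hRi : 0 < 1 / R := by positivity
    have hA1 : 1 / R ≤ rad x - t := hA.1
    have hA2 : rad x - t ≤ R := hA.2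
    have hr : 0 < rad x := by linarith
    have hx : x ≠ 0 := by
      rintro rfl
      simp [rad_zero] at hr
    obtain ⟨S, hS1, hS2, hS3⟩ := applyOps_mul fM hμ L hL hLM
    have eL : ∀ s : ℝ, 0 ≤ s → ∀ y : Spc, y ≠ 0 → eul (applyOps L f) (s, y) = rad y *
        (applyOps L f (s, y) * μ (s, y) +
          (S.map fun a => applyOps a.1 f (s, y) * applyOps a.2 μ (s, y)).sum + applyOps L g (s, y)) := by
      intro s hs y hy
      rw [eul_applyOps hf ((fM.mul hμ).add hg) (heul s hs) L hL hLM y hy]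
      have := applyOps_add (fM.mul hμ) hg L hL hLM
      have e2 := congrFun this (s, y)
      have e3 := congrFun hS3 (s, y)
      rw [← e3]
      exact congrArg _ e2
    have hsum : ∀ q : Pt, 0 ≤ q.1 →
        |(S.map fun a => applyOps a.1 f q * applyOps a.2 μ q).sum| ≤ 2 ^ n * C * ε / (1 + rad q.2) ^ 3 := by
      intro q hq
      have hrq := rad_nonneg q.2
      have := abs_listsum_le (fun a : List Op × List Op => applyOps a.1 f q * applyOps a.2 μ q)
        (C * ε / (1 + rad q.2) ^ 3) S ?_
      · refine this.trans ?_
        have hSl : (S.length : ℝ) ≤ 2 ^ n := by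
          rw [hLeq] at hS1
          have : S.length ≤ 2 ^ n := by omega
          exact_mod_cast this
        rw [mul_assoc, mul_div_assoc (2 ^ n)]
        exact mul_le_mul_of_nonneg_right hSl (by positivity)
      · intro a ha
        obtain ⟨a1, a2, a3, a4⟩ := hS2 a ha
        have b1 := ih ε hε hε8 f μ g hf hμ hg heq h0 hCM hgA hb a.1 a1 (by omega) (by omega) q hq
        have b2 : |applyOps a.2 μ q| ≤ 1 / (1 + rad q.2) ^ 2 := by
          rw [le_div_iff₀ (by positivity), mul_comm]
          exact (hμb a.2 a2 (by omega) q hq).trans (by linarith)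
        rw [abs_mul]
        calc |applyOps a.1 f q| * |applyOps a.2 μ q|
            ≤ (C * ε / (1 + rad q.2)) * (1 / (1 + rad q.2) ^ 2) := by gcongr
          _ = C * ε / (1 + rad q.2) ^ 3 := by field_simp
    have key := transport_bound ((applyOps_smooth hf L hL).differentiable (by simp)) (a := 0)
      (D := D * ε) (K := Q * ε) hx hp (by linarith) (by
        rw [mul_div_right_comm]
        gcongr
        have : 0 < R * K := by positivity
        linarith) ?_ ?_
    · have h1 : |applyOps L f (t, x)| ≤ 2 * (D * ε) / rad x := by
        rw [le_div_iff₀ hr, mul_comm]; exact key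
      refine h1.trans ?_
      rw [div_le_div_iff₀ hr (by positivity)]
      have h2 : 1 ≤ R * rad x := by
        have : 1 / R ≤ rad x := by linarith
        rw [div_le_iff₀ hR] at this
        linarith
      have h3 : 1 + rad x ≤ (1 + R) * rad x := by linarith
      have hCp : 0 ≤ C * ε * rad x := by positivity
      have := mul_le_mul_of_nonneg_left h3 (by positivity : 0 ≤ 2 * (D * ε))
      nlinarith
    · have hρ : 0 ≤ rad x - t + 0 := by linarith
      have hi := hdata ε hε f hf hCM L hL hLM 0 (by simpa using hLM)
        (((rad x - t + 0) / rad x) • x) (by rw [char_rad hx hρ]; linarith)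
      rw [norm_iteratedFDeriv_zero, Real.norm_eq_abs] at hi
      rw [abs_mul, abs_of_nonneg hρ]
      calc _ ≤ R * (K * ε) := by gcongr; linarith
        _ < D * ε := by
          rw [← mul_assoc]
          gcongr
          linarith
    · intro s hs
      have hs0 : 0 ≤ s := hs.1.le
      have hρ : 0 < rad x - t + s := by linarith
      set ρ := rad x - t + s with hρd
      set y := (ρ / rad x) • x with hy
      have hyr : rad y = ρ := char_rad hx hρ.le
      rw [eL s hs0 y (char_ne hx hρ), hyr]
      have b1 := hμb [] (by simp [IsRotMulti]) (by simp) (s, y) hs0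
      have b2 := hgb (s, y) hs0
      have b3 := hsum (s, y) hs0
      simp only [hyr, applyOps_nil] at b1 b2 b3
      generalize (S.map fun a => applyOps a.1 f (s, y) * applyOps a.2 μ (s, y)).sum = w at *
      generalize applyOps L f (s, y) = u at *
      generalize applyOps L g (s, y) = g' at *
      generalize μ (s, y) = m at *
      rw [le_div_iff₀ (by positivity)] at b3 ⊢
      have e : ρ * (u * m + w + g') = (ρ * u) * m + ρ * (w + g') := by ring
      have e1 : |ρ * (u * m + w + g')| ≤ |ρ * u| * |m| + ρ * (|w| + |g'|) := by
        rw [e]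
        refine (abs_add_le _ _).trans ?_
        rw [abs_mul (ρ * u), abs_mul ρ (w + g'), abs_of_pos hρ]
        gcongr
        exact abs_add_le _ _
      have e2 : (1 + ρ) ^ 2 * |m| ≤ 1 / 8 := b1.trans hε8
      have e3 : (|w| + |g'|) * (1 + ρ) ^ 3 ≤ Q * ε := by
        rw [hQ]; linarith
      have e4 : ρ * (|w| + |g'|) * (1 + ρ) ^ 2 ≤ (|w| + |g'|) * (1 + ρ) ^ 3 := by
        have : 0 ≤ (|w| + |g'|) * (1 + ρ) ^ 2 := by positivity
        nlinarith
      calc _ ≤ (|ρ * u| * |m| + ρ * (|w| + |g'|)) * (1 + ρ) ^ 2 := by gcongr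
        _ = |ρ * u| * ((1 + ρ) ^ 2 * |m|) + ρ * (|w| + |g'|) * (1 + ρ) ^ 2 := by ring
        _ ≤ |ρ * u| * (1 / 8) + Q * ε := by
          exact add_le_add (mul_le_mul_of_nonneg_left e2 (abs_nonneg _)) (e4.trans e3)
        _ = _ := by ring

/-- a priori decay |Ω^J f| ≤ Cε/(1+r) for rotation derivatives of a global
solution of (∂_t+∂_r+1/r)f = fμ + g. -/
theorem rotation_derivatives_decay (M : ℕ) (R : ℝ) (hR : 0 < R) :
    ∃ ε₀ > 0, ∃ C > 0, ∀ ε : ℝ, 0 < ε → ε ≤ ε₀ →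
      ∀ f μ g : Pt → ℝ, ContDiff ℝ (⊤ : ℕ∞) f → ContDiff ℝ (M : ℕ) μ → ContDiff ℝ (M : ℕ) g →
        (∀ p : Pt, 0 ≤ p.1 → p.2 ≠ 0 →
          ptd f p + prd f p + f p / rad p.2 = f p * μ p + g p) →
        (∀ x, x ∉ regA0 R → f (0, x) = 0) →
        CMBound M (fun x => f (0, x)) ε →
        (∀ p : Pt, 0 ≤ p.1 → p ∉ regA R → g p = 0) →
        (∀ L : List Op, IsMulti L → L.length ≤ M → ∀ p : Pt, 0 ≤ p.1 →
          (1 + rad p.2) ^ 2 * |applyOps L μ p| + (1 + rad p.2) ^ 3 * |applyOps L g p| ≤ ε) →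
        ∀ L : List Op, IsRotMulti L → L.length ≤ M →
          ∀ p : Pt, 0 ≤ p.1 → |applyOps L f p| ≤ C * ε / (1 + rad p.2) := by
  obtain ⟨C, hC, h⟩ := main_induction M R hR (M + 1)
  refine ⟨1 / 8, by norm_num, C, hC, ?_⟩
  intro ε hε hε8 f μ g hf hμ hg heq h0 hCM hgA hb L hL hLM
  exact h ε hε hε8 f μ g hf hμ hg heq h0 hCM hgA hb L hL (by omega) hLM
end
end
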